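/- Let g ≥ 1 and let P ∈ F_q[t] be a monic irreducible polynomial with g + 1 ≤ d(P) ≤ 2g − 1. Then ∑_{D ∈ H_{2g+1}} χ_D(P) = 0. -/

import Mathlib

open Polynomial UniqueFactorizationMonoid
open scoped Classical

noncomputable section

/-- The quadratic residue symbol `(a/P)` for `P` a monic irreducible polynomial:
`0` if `P ∣ a`, `1` if `a` is a nonzero square mod `P`, `-1` otherwise. -/
def resSym (q : ℕ) (a P : Polynomial (ZMod q)) : ℤ :=
  if P ∣ a then 0 else if ∃ b : Polynomial (ZMod q), P ∣ (a - b ^ 2) then 1 else -1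

/-- The symbol `(a/b)`, extended multiplicatively over the monic irreducible factors
of `b` (with multiplicity); by convention `(a/0) = 0`.  In particular `χ_D(f) = (D/f)`
is `jacSym q D f`, and `χ_f(h) = (f/h)` is `jacSym q f h`. -/
def jacSym (q : ℕ) [Fact q.Prime] (a b : Polynomial (ZMod q)) : ℤ :=
  if b = 0 then 0 else ((normalizedFactors b).map fun P => resSym q a P).prod

/-- The monic polynomial of degree `n` determined by the vector `v` of its
lower-order coefficients. -/
def monicOfDeg (q : ℕ) (n : ℕ) (v : Fin n → ZMod q) : Polynomial (ZMod q) :=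
  X ^ n + ∑ i : Fin n, C (v i) * X ^ (i : ℕ)

/-- The polynomial of degree `< n` with coefficient vector `v`. -/
def polyLT (q : ℕ) (n : ℕ) (v : Fin n → ZMod q) : Polynomial (ZMod q) :=
  ∑ i : Fin n, C (v i) * X ^ (i : ℕ)

/-- Sum of `F` over all monic polynomials of degree `m`; empty for `m < 0`. -/
def sumMonic (q : ℕ) [NeZero q] {M : Type*} [AddCommMonoid M] (m : ℤ)
    (F : Polynomial (ZMod q) → M) : M :=
  if 0 ≤ m then ∑ v : Fin m.toNat → ZMod q, F (monicOfDeg q m.toNat v) else 0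

/-- Sum of `F` over all monic polynomials of degree `≤ n`; empty for `n < 0`. -/
def sumMonicLE (q : ℕ) [NeZero q] {M : Type*} [AddCommMonoid M] (n : ℤ)
    (F : Polynomial (ZMod q) → M) : M :=
  if 0 ≤ n then ∑ m ∈ Finset.range (n.toNat + 1), sumMonic q (m : ℤ) F else 0

/-- Sum of `F` over the set `H_{2g+1}` of monic squarefree polynomials of degree `2g+1`. -/
def sumH (q : ℕ) [NeZero q] {M : Type*} [AddCommMonoid M] (g : ℕ)
    (F : Polynomial (ZMod q) → M) : M :=
  ∑ v : Fin (2 * g + 1) → ZMod q,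
    if Squarefree (monicOfDeg q (2 * g + 1) v) then F (monicOfDeg q (2 * g + 1) v) else 0

/-- `e(a/f)` for monic `f`: the additive character `exp(2πi a₁/q)` where `a₁` is the
coefficient of `t⁻¹` in the expansion of `a/f` at infinity, namely the coefficient of
`t^{deg f - 1}` in `a mod f`. -/
def ePoly (q : ℕ) (a f : Polynomial (ZMod q)) : ℂ :=
  Complex.exp (2 * Real.pi * Complex.I *
    (((a %ₘ f).coeff (f.natDegree - 1)).val : ℂ) / q)

/-- The generalized Gauss sum `G(V, f) = ∑_{u mod f} χ_f(u) e(uV/f)`, the sum running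
over the residues `u` modulo `f`, i.e. the polynomials of degree `< deg f`. -/
def gaussS (q : ℕ) [Fact q.Prime] (V f : Polynomial (ZMod q)) : ℂ :=
  ∑ v : Fin f.natDegree → ZMod q,
    (jacSym q f (polyLT q f.natDegree v) : ℂ) * ePoly q (polyLT q f.natDegree v * V) f

/-- The von Mangoldt function: `Λ(f) = deg P` if `f = P^k` with `P` monic irreducible
and `k ≥ 1`, and `0` otherwise. -/
def vM (q : ℕ) (f : Polynomial (ZMod q)) : ℕ :=
  if h : ∃ P : Polynomial (ZMod q), (∃ k : ℕ, 1 ≤ k ∧ f = P ^ k) ∧ P.Monic ∧ Irreducible P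
  then h.choose.natDegree else 0

/-- The monic irreducible polynomials of `F_q[t]`. -/
abbrev MonicIrr (q : ℕ) := {P : Polynomial (ZMod q) // P.Monic ∧ Irreducible P}

/-- `B(α) = ∑_P d(P) / ((|P|^{1+2α} - 1)(|P| + 1))`, over monic irreducible `P`. -/
def Bsum (q : ℕ) (α : ℂ) : ℂ :=
  ∑' P : MonicIrr q, (P.1.natDegree : ℂ) /
    (((q : ℂ) ^ ((P.1.natDegree : ℂ) * (1 + 2 * α)) - 1) * ((q : ℂ) ^ P.1.natDegree + 1))

end

section MonicSums

variable {q : ℕ}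

theorem polyLT_coeff_eq {n : ℕ} {f : (ZMod q)[X]} (hf : f.degree < n) :
    polyLT q n (fun i => f.coeff i) = f := by
  rw [polyLT, Fin.sum_univ_eq_sum_range (fun i => C (f.coeff i) * X ^ i) n]
  by_cases h0 : f = 0
  · simp [h0]
  · exact (f.as_sum_range_C_mul_X_pow' ((natDegree_lt_iff_degree_lt h0).2 hf)).symm

theorem polyLT_degree_lt (n : ℕ) (v : Fin n → ZMod q) : (polyLT q n v).degree < n := by
  rw [polyLT, degree_lt_iff_coeff_zero]
  intro m hm
  rw [finsetSum_coeff]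
  refine Finset.sum_eq_zero fun i _ => ?_
  rw [coeff_C_mul_X_pow, if_neg]
  have := i.2
  omega

theorem polyLT_add (n : ℕ) (v w : Fin n → ZMod q) :
    polyLT q n (v + w) = polyLT q n v + polyLT q n w := by
  simp [polyLT, add_mul, Finset.sum_add_distrib]

theorem polyLT_coeff {n : ℕ} (v : Fin n → ZMod q) (i : Fin n) :
    (polyLT q n v).coeff i = v i := by
  simp [polyLT, finsetSum_coeff, Fin.val_inj]

theorem monicOfDeg_eq (n : ℕ) (v : Fin n → ZMod q) :
    monicOfDeg q n v = X ^ n + polyLT q n v := rfl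

theorem monicOfDeg_injective (n : ℕ) : Function.Injective (monicOfDeg q n) := by
  intro v w h
  rw [monicOfDeg_eq, monicOfDeg_eq, add_right_inj] at h
  funext i
  rw [← polyLT_coeff v i, h, polyLT_coeff]

variable [Fact q.Prime]

/-- The finite set of monic polynomials of degree `n`. -/
noncomputable def monics (q : ℕ) [Fact q.Prime] (n : ℕ) : Finset (ZMod q)[X] :=
  Finset.univ.image (monicOfDeg q n)

theorem mem_monics {n : ℕ} {f : (ZMod q)[X]} :
    f ∈ monics q n ↔ f.Monic ∧ f.natDegree = n := by
  simp only [monics, Finset.mem_image, Finset.mem_univ, true_and]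
  constructor
  · rintro ⟨v, rfl⟩
    have hv := polyLT_degree_lt n v
    refine ⟨monic_X_pow_add hv, ?_⟩
    rw [monicOfDeg_eq, natDegree_eq_of_degree_eq_some]
    rw [degree_add_eq_left_of_degree_lt] <;> simp [hv]
  · rintro ⟨hf, rfl⟩
    refine ⟨fun i => (f - X ^ f.natDegree).coeff i, ?_⟩
    rw [monicOfDeg_eq, polyLT_coeff_eq, add_sub_cancel]
    have h := degree_sub_lt_left (p := f) (q := X ^ f.natDegree)
      (by rw [degree_X_pow, degree_eq_natDegree hf.ne_zero]) hf.ne_zero (by simp [hf.leadingCoeff])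
    rwa [degree_eq_natDegree hf.ne_zero] at h

theorem card_monics (n : ℕ) : (monics q n).card = q ^ n := by
  rw [monics, Finset.card_image_of_injective _ (monicOfDeg_injective n)]
  simp [ZMod.card]

theorem sum_monics {M : Type*} [AddCommMonoid M] (n : ℕ) (F : (ZMod q)[X] → M) :
    ∑ f ∈ monics q n, F f = ∑ v, F (monicOfDeg q n v) :=
  Finset.sum_image fun _ _ _ _ h => monicOfDeg_injective n h

/-- The finite set of monic squarefree polynomials of degree `n`. -/
noncomputable def squarefreeMonics (q : ℕ) [Fact q.Prime] (n : ℕ) : Finset (ZMod q)[X] :=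
  (monics q n).filter Squarefree

theorem mem_squarefreeMonics {n : ℕ} {f : (ZMod q)[X]} :
    f ∈ squarefreeMonics q n ↔ (f.Monic ∧ f.natDegree = n) ∧ Squarefree f := by
  rw [squarefreeMonics, Finset.mem_filter, mem_monics]

theorem sumH_eq_sum_squarefreeMonics {M : Type*} [AddCommMonoid M] (g : ℕ)
    (F : (ZMod q)[X] → M) : sumH q g F = ∑ f ∈ squarefreeMonics q (2 * g + 1), F f := by
  rw [squarefreeMonics, Finset.sum_filter, sum_monics, sumH]

end MonicSums

section SquarefreeDecomposition

variable {K : Type*} [Field K]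

theorem exists_squarefree_mul_sq {f : K[X]} (hf : f.Monic) :
    ∃ D l : K[X], D.Monic ∧ l.Monic ∧ Squarefree D ∧ D * l ^ 2 = f := by
  induction hn : f.natDegree using Nat.strong_induction_on generalizing f with
  | _ n ih =>
    by_cases hs : Squarefree f
    · exact ⟨f, 1, hf, monic_one, hs, by simp⟩
    · obtain ⟨x, hx, hxu⟩ : ∃ x, x * x ∣ f ∧ ¬IsUnit x := by
        simpa [Squarefree] using hs
      have hx0 : x ≠ 0 := by
        rintro rfl
        exact hf.ne_zero (by simpa using hx)
      have hy : (normalize x).Monic := monic_normalize hx0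
      obtain ⟨c, hc⟩ : normalize x * normalize x ∣ f :=
        (mul_dvd_mul (normalize_associated x).dvd (normalize_associated x).dvd).trans hx
      have hcm : c.Monic := (hy.mul hy).of_mul_monic_left (hc ▸ hf)
      have hdeg : 0 < (normalize x).natDegree := by
        rw [Nat.pos_iff_ne_zero]
        intro h0
        refine hxu ((normalize_associated x).isUnit_iff.1 ?_)
        rw [hy.natDegree_eq_zero.1 h0]
        exact isUnit_one
      have hlt : c.natDegree < n := by
        rw [← hn, hc, (hy.mul hy).natDegree_mul hcm, hy.natDegree_mul hy]
        omega
      obtain ⟨D, l, hD, hl, hDs, h⟩ := ih _ hlt hcm rfl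
      refine ⟨D, l * normalize x, hD, hl.mul hy, hDs, ?_⟩
      rw [hc, ← h]
      ring

theorem eq_of_squarefree_mul_sq_eq {D D' l l' : K[X]} (hD : D.Monic) (hD' : D'.Monic)
    (hl : l.Monic) (hl' : l'.Monic) (hs : Squarefree D) (hs' : Squarefree D')
    (h : D * l ^ 2 = D' * l' ^ 2) : D = D' ∧ l = l' := by
  have hfac := congrArg normalizedFactors h
  rw [normalizedFactors_mul hD.ne_zero (hl.pow 2).ne_zero,
    normalizedFactors_mul hD'.ne_zero (hl'.pow 2).ne_zero, normalizedFactors_pow,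
    normalizedFactors_pow] at hfac
  have hn := Multiset.nodup_iff_count_le_one.1
    ((squarefree_iff_nodup_normalizedFactors hD.ne_zero).1 hs)
  have hn' := Multiset.nodup_iff_count_le_one.1
    ((squarefree_iff_nodup_normalizedFactors hD'.ne_zero).1 hs')
  have hcount (p : K[X]) := congrArg (Multiset.count p) hfac
  simp only [Multiset.count_add, Multiset.count_nsmul] at hcount
  have eq_of {a b : K[X]} (ha : a.Monic) (hb : b.Monic)
      (hab : normalizedFactors a = normalizedFactors b) : a = b :=
    eq_of_monic_of_associated ha hb
      ((associated_iff_normalizedFactors_eq_normalizedFactors ha.ne_zero hb.ne_zero).2 hab)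
  constructor
  · refine eq_of hD hD' (Multiset.ext.2 fun p => ?_)
    have := hcount p; have := hn p; have := hn' p
    omega
  · refine eq_of hl hl' (Multiset.ext.2 fun p => ?_)
    have := hcount p; have := hn p; have := hn' p
    omega

end SquarefreeDecomposition

section Symbol

variable {q : ℕ} [Fact q.Prime]

theorem sum_monics_eq_sum_squarefree {M : Type*} [AddCommMonoid M] (n : ℕ)
    (F : (ZMod q)[X] → M) :
    ∑ f ∈ monics q n, F f = ∑ j ∈ Finset.range (n / 2 + 1), ∑ l ∈ monics q j,
      ∑ D ∈ squarefreeMonics q (n - 2 * j), F (D * l ^ 2) := by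
  simp_rw [← Finset.sum_product', Finset.sum_sigma']
  symm
  refine Finset.sum_bij (fun x _ => x.2.2 * x.2.1 ^ 2) ?_ ?_ ?_ ?_
  · rintro ⟨j, l, D⟩ h
    simp only [Finset.mem_sigma, Finset.mem_range, Finset.mem_product, mem_monics,
      mem_squarefreeMonics] at h
    obtain ⟨hj, ⟨hl, hlj⟩, ⟨hD, hDn⟩, -⟩ := h
    rw [mem_monics, hD.natDegree_mul (hl.pow 2), hl.natDegree_pow]
    exact ⟨hD.mul (hl.pow 2), by omega⟩
  · rintro ⟨j, l, D⟩ h ⟨j', l', D'⟩ h' heq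
    simp only [Finset.mem_sigma, Finset.mem_range, Finset.mem_product, mem_monics,
      mem_squarefreeMonics] at h h'
    obtain ⟨-, ⟨hl, rfl⟩, ⟨hD, -⟩, hs⟩ := h
    obtain ⟨-, ⟨hl', rfl⟩, ⟨hD', -⟩, hs'⟩ := h'
    obtain ⟨rfl, rfl⟩ := eq_of_squarefree_mul_sq_eq hD hD' hl hl' hs hs' heq
    rfl
  · intro f hf
    rw [mem_monics] at hf
    obtain ⟨D, l, hD, hl, hs, h⟩ := exists_squarefree_mul_sq hf.1
    have hdeg : D.natDegree + 2 * l.natDegree = n := by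
      rw [← hf.2, ← h, hD.natDegree_mul (hl.pow 2), hl.natDegree_pow]
    refine ⟨⟨l.natDegree, l, D⟩, ?_, h⟩
    simp only [Finset.mem_sigma, Finset.mem_range, Finset.mem_product, mem_monics,
      mem_squarefreeMonics]
    exact ⟨by omega, ⟨hl, trivial⟩, ⟨hD, by omega⟩, hs⟩
  · intros
    rfl

theorem jacSym_of_irreducible {P : (ZMod q)[X]} (hP : P.Monic) (hirr : Irreducible P)
    (a : (ZMod q)[X]) : jacSym q a P = resSym q a P := by
  rw [jacSym, if_neg hP.ne_zero, normalizedFactors_irreducible hirr, hP.normalize_eq_self]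
  simp

theorem resSym_eq_quadraticChar {P : (ZMod q)[X]} [Fact (Irreducible P)]
    [Fintype (AdjoinRoot P)] (a : (ZMod q)[X]) :
    resSym q a P = quadraticChar (AdjoinRoot P) (AdjoinRoot.mk P a) := by
  have hsq : (∃ b, P ∣ a - b ^ 2) ↔ IsSquare (AdjoinRoot.mk P a) := by
    rw [isSquare_iff_exists_sq, AdjoinRoot.mk_surjective.exists]
    simp_rw [← map_pow, AdjoinRoot.mk_eq_mk]
  rw [resSym, quadraticChar_apply, quadraticCharFun]
  simp only [hsq, AdjoinRoot.mk_eq_zero]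

theorem mk_polyLT_surjective {P : (ZMod q)[X]} (hP : P.Monic) {n : ℕ} (hn : P.natDegree ≤ n) :
    Function.Surjective fun v => AdjoinRoot.mk P (polyLT q n v) := by
  intro x
  obtain ⟨f, rfl⟩ := AdjoinRoot.mk_surjective x
  have hlt : (f %ₘ P).degree < n :=
    (degree_modByMonic_lt f hP).trans_le (degree_le_of_natDegree_le hn)
  refine ⟨fun i => (f %ₘ P).coeff i, ?_⟩
  simp only [polyLT_coeff_eq hlt]
  rw [AdjoinRoot.mk_eq_mk, ← dvd_neg, neg_sub]
  exact ⟨f /ₘ P, by linear_combination (modByMonic_add_div f P).symm⟩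

theorem finite_adjoinRoot {P : (ZMod q)[X]} (hP : P.Monic) : Finite (AdjoinRoot P) :=
  Finite.of_surjective _ (mk_polyLT_surjective hP le_rfl)

theorem resSym_mul_sq {P : (ZMod q)[X]} (hP : P.Monic) (hirr : Irreducible P) {l : (ZMod q)[X]}
    (hl : ¬P ∣ l) (a : (ZMod q)[X]) : resSym q (a * l ^ 2) P = resSym q a P := by
  have : Fact (Irreducible P) := ⟨hirr⟩
  have := finite_adjoinRoot hP
  have := Fintype.ofFinite (AdjoinRoot P)
  have hl0 : AdjoinRoot.mk P l ≠ 0 := by rwa [Ne, AdjoinRoot.mk_eq_zero]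
  rw [resSym_eq_quadraticChar, resSym_eq_quadraticChar, map_mul, map_mul, map_pow,
    quadraticChar_sq_one' hl0, mul_one]

theorem sum_resSym_monics (hq : q ≠ 2) {P : (ZMod q)[X]} (hP : P.Monic) (hirr : Irreducible P)
    {n : ℕ} (hn : P.natDegree ≤ n) : ∑ f ∈ monics q n, resSym q f P = 0 := by
  have : Fact (Irreducible P) := ⟨hirr⟩
  have := finite_adjoinRoot hP
  have := Fintype.ofFinite (AdjoinRoot P)
  have : CharP (AdjoinRoot P) q :=
    charP_of_injective_algebraMap (algebraMap (ZMod q) (AdjoinRoot P)).injective q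
  have hchar : ringChar (AdjoinRoot P) ≠ 2 := by rwa [ringChar.eq (AdjoinRoot P) q]
  simp_rw [resSym_eq_quadraticChar]
  rw [sum_monics]
  have hshift (h : AdjoinRoot P) :
      ∑ v, quadraticChar (AdjoinRoot P) (AdjoinRoot.mk P (monicOfDeg q n v)) =
        ∑ v, quadraticChar (AdjoinRoot P) (AdjoinRoot.mk P (monicOfDeg q n v) + h) := by
    obtain ⟨w, rfl⟩ := mk_polyLT_surjective hP hn h
    rw [← Equiv.sum_comp (Equiv.addRight w)]
    simp [monicOfDeg_eq, polyLT_add, add_assoc]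
  have hcard : (Fintype.card (AdjoinRoot P) : ℤ) *
      ∑ v, quadraticChar (AdjoinRoot P) (AdjoinRoot.mk P (monicOfDeg q n v)) = 0 := by
    rw [← nsmul_eq_mul, ← Finset.card_univ, ← Finset.sum_const, Finset.sum_congr rfl
      fun h _ => hshift h, Finset.sum_comm]
    refine Finset.sum_eq_zero fun v _ => ?_
    rw [← quadraticChar_sum_zero hchar]
    exact Equiv.sum_comp (Equiv.addLeft (AdjoinRoot.mk P (monicOfDeg q n v))) (quadraticChar (AdjoinRoot P))
  exact (mul_eq_zero.1 hcard).resolve_left (by exact_mod_cast Fintype.card_ne_zero)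

theorem sum_resSym_monics_eq {P : (ZMod q)[X]} (hP : P.Monic) (hirr : Irreducible P) {n : ℕ}
    (hn : n / 2 < P.natDegree) :
    ∑ f ∈ monics q n, resSym q f P = ∑ j ∈ Finset.range (n / 2 + 1),
      (q : ℤ) ^ j * ∑ D ∈ squarefreeMonics q (n - 2 * j), resSym q D P := by
  rw [sum_monics_eq_sum_squarefree]
  refine Finset.sum_congr rfl fun j hj => ?_
  rw [← Nat.cast_pow, ← card_monics, ← nsmul_eq_mul, ← Finset.sum_const]
  refine Finset.sum_congr rfl fun l hl => Finset.sum_congr rfl fun D _ => ?_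
  rw [mem_monics] at hl
  rw [Finset.mem_range] at hj
  refine resSym_mul_sq hP hirr (fun hdvd => ?_) D
  have := natDegree_le_of_dvd hdvd hl.1.ne_zero
  omega

end Symbol

/-- for `g ≥ 1` and `P` monic irreducible with
`g + 1 ≤ d(P) ≤ 2g - 1`, the sum `∑_{D ∈ H_{2g+1}} χ_D(P)` vanishes. -/
theorem statement10 (q : ℕ) [Fact q.Prime] (hq4 : q % 4 = 1) (g : ℕ) (hg : 1 ≤ g)
    (P : Polynomial (ZMod q)) (hP : P.Monic) (hirr : Irreducible P)
    (h1 : g + 1 ≤ P.natDegree) (h2 : P.natDegree ≤ 2 * g - 1) :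
    sumH q g (fun D => (jacSym q D P : ℤ)) = 0 := by
  simp_rw [jacSym_of_irreducible hP hirr]
  rw [sumH_eq_sum_squarefreeMonics]
  have hq : q ≠ 2 := by omega
  have hodd := sum_resSym_monics_eq hP hirr (n := 2 * g + 1) (by omega)
  have hprev := sum_resSym_monics_eq hP hirr (n := 2 * g - 1) (by omega)
  rw [sum_resSym_monics hq hP hirr (by omega)] at hodd hprev
  rw [show (2 * g + 1) / 2 + 1 = g + 1 by omega, Finset.sum_range_succ'] at hodd
  rw [show (2 * g - 1) / 2 + 1 = g by omega] at hprev
  have hstep : ∑ j ∈ Finset.range g, (q : ℤ) ^ (j + 1) *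
      ∑ D ∈ squarefreeMonics q (2 * g + 1 - 2 * (j + 1)), resSym q D P = 0 := by
    rw [← mul_zero (q : ℤ), hprev, Finset.mul_sum]
    refine Finset.sum_congr rfl fun j _ => ?_
    rw [show 2 * g + 1 - 2 * (j + 1) = 2 * g - 1 - 2 * j by omega]
    ring
  rw [hstep] at hodd
  simpa using hodd.symm
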